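/- There exists an absolute constant c > 0 (chosen small enough) with the following property. Assume μ ≤ c/(‖X‖κ), ‖Z_t‖ ≤ 2√‖X‖, ‖L_{X,⊥}ᵀP_{Z_tQ_t}‖ ≤ c/κ, ‖Δ_t‖ ≤ cσ_min(X), and that L_XᵀZ_tQ_t is invertible. Then σ_min(L_XᵀZ_{t+1}) ≥ σ_min(L_XᵀZ_{t+1}Q_t) ≥ σ_min(L_XᵀZ_t) · (1 + (1/4)μσ_min(X) − μσ_min²(L_XᵀZ_t)). -/

import Mathlib

open Matrix MeasureTheory ProbabilityTheory

noncomputable section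

namespace AsymMatrixSensing

/-- Euclidean norm of a real vector. -/
def euclNorm {ι : Type*} [Fintype ι] (v : ι → ℝ) : ℝ :=
  Real.sqrt (∑ i, v i ^ 2)

/-- Spectral norm of a real matrix. -/
def specNorm {ι₁ ι₂ : Type*} [Fintype ι₁] [Fintype ι₂] (M : Matrix ι₁ ι₂ ℝ) : ℝ :=
  sSup {c : ℝ | ∃ x : ι₂ → ℝ, euclNorm x ≤ 1 ∧ c = euclNorm (M.mulVec x)}

/-- Frobenius norm of a real matrix. -/
def frobNorm {ι₁ ι₂ : Type*} [Fintype ι₁] [Fintype ι₂] (M : Matrix ι₁ ι₂ ℝ) : ℝ :=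
  Real.sqrt (∑ i, ∑ j, M i j ^ 2)

/-- Nuclear norm of a real matrix (characterized by duality with the spectral norm). -/
def nucNorm {ι₁ ι₂ : Type*} [Fintype ι₁] [Fintype ι₂] (M : Matrix ι₁ ι₂ ℝ) : ℝ :=
  sSup {c : ℝ | ∃ B : Matrix ι₁ ι₂ ℝ, specNorm B ≤ 1 ∧ c = ∑ i, ∑ j, M i j * B i j}

/-- Smallest singular value `σ_{min(a,b)}(M)` of a matrix. -/
def sigmaMin {ι₁ ι₂ : Type*} [Fintype ι₁] [Fintype ι₂] (M : Matrix ι₁ ι₂ ℝ) : ℝ :=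
  max (sInf {c : ℝ | ∃ x : ι₂ → ℝ, euclNorm x = 1 ∧ c = euclNorm (M.mulVec x)})
      (sInf {c : ℝ | ∃ y : ι₁ → ℝ, euclNorm y = 1 ∧ c = euclNorm (Mᵀ.mulVec y)})

/-- Smallest nonzero singular value `σ_rank(M)`: the minimum of `‖Mx‖` over unit
vectors `x` orthogonal to the kernel of `M`. -/
def sigmaPos {ι₁ ι₂ : Type*} [Fintype ι₁] [Fintype ι₂] (M : Matrix ι₁ ι₂ ℝ) : ℝ :=
  sInf {c : ℝ | ∃ x : ι₂ → ℝ, euclNorm x = 1 ∧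
    (∀ y : ι₂ → ℝ, M.mulVec y = 0 → x ⬝ᵥ y = 0) ∧ c = euclNorm (M.mulVec x)}

/-- Condition number `κ = ‖M‖ / σ_min(M)`. -/
def condNum {ι₁ ι₂ : Type*} [Fintype ι₁] [Fintype ι₂] (M : Matrix ι₁ ι₂ ℝ) : ℝ :=
  specNorm M / sigmaPos M

/-- Trace inner product `⟨M, N⟩ = trace(Mᵀ N)`. -/
def minner {ι₁ ι₂ : Type*} [Fintype ι₁] [Fintype ι₂] (M N : Matrix ι₁ ι₂ ℝ) : ℝ :=
  ∑ i, ∑ j, M i j * N i j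

/-- `P` is a matrix with orthonormal columns spanning the column space of `M`. -/
def IsOrthCol {ι κ₁ κ₂ : Type*} [Fintype ι] [Fintype κ₁] [Fintype κ₂] [DecidableEq κ₂]
    (P : Matrix ι κ₂ ℝ) (M : Matrix ι κ₁ ℝ) : Prop :=
  Pᵀ * P = 1 ∧ (∃ C : Matrix κ₁ κ₂ ℝ, P = M * C) ∧ P * Pᵀ * M = M

/-- `L` has orthonormal columns spanning the subspace spanned by eigenvectors of the
symmetric matrix `F` corresponding to its `r` largest eigenvalues. -/
def IsTopEigenspace {ι : Type*} [Fintype ι] [DecidableEq ι] {r : ℕ} (F : Matrix ι ι ℝ)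
    (L : Matrix ι (Fin r) ℝ) : Prop :=
  Lᵀ * L = 1 ∧ ∃ d : Fin r → ℝ, F * L = L * Matrix.diagonal d ∧
    ∀ (v : ι → ℝ) (lam : ℝ), v ≠ 0 → F.mulVec v = lam • v →
      Lᵀ.mulVec v = 0 → ∀ i, lam ≤ d i

variable {n₁ n₂ m k r : ℕ}

/-- The measurement operator `𝒜`, given by `[𝒜(Z)]ᵢ = ⟨Aᵢ, Z⟩`. -/
def calA (A : Fin m → Matrix (Fin n₁) (Fin n₂) ℝ) (Z : Matrix (Fin n₁) (Fin n₂) ℝ) :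
    Fin m → ℝ := fun i => minner (A i) Z

/-- The restricted isometry property of order `s` with constant `δ`. -/
def HasRIP (A : Fin m → Matrix (Fin n₁) (Fin n₂) ℝ) (s : ℕ) (δ : ℝ) : Prop :=
  ∀ M : Matrix (Fin n₁) (Fin n₂) ℝ, M.rank ≤ s →
    (1 - δ) * frobNorm M ^ 2 ≤ ∑ i, calA A M i ^ 2 ∧
      ∑ i, calA A M i ^ 2 ≤ (1 + δ) * frobNorm M ^ 2

/-- `𝒜*𝒜`. -/
def AstarA (A : Fin m → Matrix (Fin n₁) (Fin n₂) ℝ) (Z : Matrix (Fin n₁) (Fin n₂) ℝ) :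
    Matrix (Fin n₁) (Fin n₂) ℝ := ∑ i, minner (A i) Z • A i

/-- The symmetrization `sym(X) = [[0, X], [Xᵀ, 0]]`. -/
def symMat (X : Matrix (Fin n₁) (Fin n₂) ℝ) :
    Matrix (Fin n₁ ⊕ Fin n₂) (Fin n₁ ⊕ Fin n₂) ℝ := Matrix.fromBlocks 0 X Xᵀ 0

/-- The symmetrized measurement matrices `Bᵢ = (1/√2)[[0, Aᵢ], [Aᵢᵀ, 0]]`. -/
def Bmat (A : Fin m → Matrix (Fin n₁) (Fin n₂) ℝ) (i : Fin m) :
    Matrix (Fin n₁ ⊕ Fin n₂) (Fin n₁ ⊕ Fin n₂) ℝ :=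
  (Real.sqrt 2)⁻¹ • Matrix.fromBlocks 0 (A i) (A i)ᵀ 0

/-- `ℬ*ℬ`. -/
def BstarB (A : Fin m → Matrix (Fin n₁) (Fin n₂) ℝ)
    (S : Matrix (Fin n₁ ⊕ Fin n₂) (Fin n₁ ⊕ Fin n₂) ℝ) :
    Matrix (Fin n₁ ⊕ Fin n₂) (Fin n₁ ⊕ Fin n₂) ℝ :=
  ∑ i, minner (Bmat A i) S • Bmat A i

/-- The factorized gradient descent iterates `(V_t, W_t)`. -/
def iter (A : Fin m → Matrix (Fin n₁) (Fin n₂) ℝ) (X : Matrix (Fin n₁) (Fin n₂) ℝ)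
    (μ : ℝ) (V₀ : Matrix (Fin n₁) (Fin k) ℝ) (W₀ : Matrix (Fin n₂) (Fin k) ℝ) :
    ℕ → Matrix (Fin n₁) (Fin k) ℝ × Matrix (Fin n₂) (Fin k) ℝ
  | 0 => (V₀, W₀)
  | t + 1 =>
    let p := iter A X μ V₀ W₀ t
    let G := AstarA A (p.1 * p.2ᵀ - X)
    (p.1 - μ • (G * p.2), p.2 - μ • (Gᵀ * p.1))

/-- The vertical stacking `(1/√2)[V; W]`. -/
def Zstack {κ : ℕ} (V : Matrix (Fin n₁) (Fin κ) ℝ) (W : Matrix (Fin n₂) (Fin κ) ℝ) :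
    Matrix (Fin n₁ ⊕ Fin n₂) (Fin κ) ℝ :=
  (Real.sqrt 2)⁻¹ • Matrix.fromRows V W

/-- `Z_t = (1/√2)[V_t; W_t]`. -/
def Zit (A : Fin m → Matrix (Fin n₁) (Fin n₂) ℝ) (X : Matrix (Fin n₁) (Fin n₂) ℝ)
    (μ : ℝ) (V₀ : Matrix (Fin n₁) (Fin k) ℝ) (W₀ : Matrix (Fin n₂) (Fin k) ℝ) (t : ℕ) :
    Matrix (Fin n₁ ⊕ Fin n₂) (Fin k) ℝ :=
  Zstack (iter A X μ V₀ W₀ t).1 (iter A X μ V₀ W₀ t).2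

/-- `Z̃_t = (1/√2)[V_t; −W_t]`. -/
def Ztil (A : Fin m → Matrix (Fin n₁) (Fin n₂) ℝ) (X : Matrix (Fin n₁) (Fin n₂) ℝ)
    (μ : ℝ) (V₀ : Matrix (Fin n₁) (Fin k) ℝ) (W₀ : Matrix (Fin n₂) (Fin k) ℝ) (t : ℕ) :
    Matrix (Fin n₁ ⊕ Fin n₂) (Fin k) ℝ :=
  Zstack (iter A X μ V₀ W₀ t).1 (-(iter A X μ V₀ W₀ t).2)

/-- `Δ_t = (Id − ℬ*ℬ)(Z_tZ_tᵀ − Z̃_tZ̃_tᵀ − sym(X))`. -/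
def Δit (A : Fin m → Matrix (Fin n₁) (Fin n₂) ℝ) (X : Matrix (Fin n₁) (Fin n₂) ℝ)
    (μ : ℝ) (V₀ : Matrix (Fin n₁) (Fin k) ℝ) (W₀ : Matrix (Fin n₂) (Fin k) ℝ) (t : ℕ) :
    Matrix (Fin n₁ ⊕ Fin n₂) (Fin n₁ ⊕ Fin n₂) ℝ :=
  let D := Zit A X μ V₀ W₀ t * (Zit A X μ V₀ W₀ t)ᵀ
    - Ztil A X μ V₀ W₀ t * (Ztil A X μ V₀ W₀ t)ᵀ - symMat X
  D - BstarB A D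

/-- The block diagonal matrix `diag(Id_{n₁}, −Id_{n₂})`. -/
def flipSign (n₁ n₂ : ℕ) : Matrix (Fin n₁ ⊕ Fin n₂) (Fin n₁ ⊕ Fin n₂) ℝ :=
  Matrix.fromBlocks 1 0 0 (-1)

/-- Product Gaussian measure modelling the random initialization pair `(V, W)`
with i.i.d. standard Gaussian entries. -/
def gaussPair (n₁ n₂ k : ℕ) :
    Measure ((Fin n₁ → Fin k → ℝ) × (Fin n₂ → Fin k → ℝ)) :=
  (Measure.pi fun _ : Fin n₁ => Measure.pi fun _ : Fin k => gaussianReal 0 1).prod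
    (Measure.pi fun _ : Fin n₂ => Measure.pi fun _ : Fin k => gaussianReal 0 1)

section aux

variable {ι ι' ι'' : Type*} [Fintype ι] [Fintype ι'] [Fintype ι'']

lemma en_nonneg (v : ι → ℝ) : 0 ≤ euclNorm v := Real.sqrt_nonneg _

lemma en_sq (v : ι → ℝ) : euclNorm v ^ 2 = v ⬝ᵥ v := by
  unfold euclNorm
  rw [Real.sq_sqrt (Finset.sum_nonneg fun i _ => sq_nonneg _)]
  simp [dotProduct, sq]

lemma en_eq_of_sq {v : ι → ℝ} {w : ι' → ℝ} (h : v ⬝ᵥ v = w ⬝ᵥ w) : euclNorm v = euclNorm w := by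
  rw [← en_sq, ← en_sq] at h
  exact (sq_eq_sq₀ (en_nonneg _) (en_nonneg _)).1 h

lemma abs_dot_le (u v : ι → ℝ) : |u ⬝ᵥ v| ≤ euclNorm u * euclNorm v := by
  refine abs_le_of_sq_le_sq ?_ (mul_nonneg (en_nonneg _) (en_nonneg _))
  rw [mul_pow, en_sq, en_sq]
  have := Finset.sum_mul_sq_le_sq_mul_sq Finset.univ u v
  simpa [dotProduct, sq] using this

lemma dot_le (u v : ι → ℝ) : u ⬝ᵥ v ≤ euclNorm u * euclNorm v :=
  (le_abs_self _).trans (abs_dot_le u v)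

lemma en_zero : euclNorm (0 : ι → ℝ) = 0 := by simp [euclNorm]

lemma en_smul (a : ℝ) (v : ι → ℝ) : euclNorm (a • v) = |a| * euclNorm v := by
  have : euclNorm (a • v) ^ 2 = (|a| * euclNorm v) ^ 2 := by
    rw [mul_pow, en_sq, en_sq, sq_abs]; simp [sq, mul_assoc]
  exact (sq_eq_sq₀ (en_nonneg _) (mul_nonneg (abs_nonneg _) (en_nonneg _))).1 this

lemma en_eq_zero {v : ι → ℝ} (h : euclNorm v = 0) : v = 0 := by
  have := en_sq v
  rw [h] at this
  exact dotProduct_self_eq_zero.1 (by linarith)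

lemma dot_mulVec_t (M : Matrix ι ι' ℝ) (x : ι' → ℝ) (y : ι → ℝ) :
    (M *ᵥ x) ⬝ᵥ y = x ⬝ᵥ (Mᵀ *ᵥ y) := by
  rw [Matrix.mulVec_transpose, dotProduct_comm, Matrix.dotProduct_mulVec, dotProduct_comm]

lemma en_mulVec_frob (M : Matrix ι ι' ℝ) (x : ι' → ℝ) :
    euclNorm (M *ᵥ x) ≤ frobNorm M * euclNorm x := by
  have : euclNorm (M *ᵥ x) ^ 2 ≤ (frobNorm M * euclNorm x) ^ 2 := by
    rw [mul_pow]
    unfold euclNorm frobNorm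
    have hf : 0 ≤ ∑ i, ∑ j, M i j ^ 2 :=
      Finset.sum_nonneg fun i _ => Finset.sum_nonneg fun j _ => sq_nonneg (M i j)
    rw [Real.sq_sqrt (Finset.sum_nonneg fun i _ => sq_nonneg _),
      Real.sq_sqrt (Finset.sum_nonneg fun i _ => sq_nonneg _),
      Real.sq_sqrt hf, Finset.sum_mul]
    apply Finset.sum_le_sum
    intro i _
    exact Finset.sum_mul_sq_le_sq_mul_sq Finset.univ (M i) x
  exact (sq_le_sq₀ (en_nonneg _) (mul_nonneg (Real.sqrt_nonneg _) (en_nonneg _))).1 this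

lemma spec_bdd (M : Matrix ι ι' ℝ) :
    BddAbove {c : ℝ | ∃ x : ι' → ℝ, euclNorm x ≤ 1 ∧ c = euclNorm (M.mulVec x)} := by
  refine ⟨frobNorm M, ?_⟩
  rintro c ⟨x, hx, rfl⟩
  refine (en_mulVec_frob M x).trans ?_
  exact mul_le_of_le_one_right (Real.sqrt_nonneg _) hx

lemma spec_nonneg (M : Matrix ι ι' ℝ) : 0 ≤ specNorm M := by
  apply Real.sSup_nonneg
  rintro c ⟨x, hx, rfl⟩
  exact en_nonneg _

lemma en_unit {x : ι → ℝ} (h : euclNorm x ≠ 0) : euclNorm ((euclNorm x)⁻¹ • x) = 1 := by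
  rw [en_smul, abs_of_nonneg (inv_nonneg.2 (en_nonneg _)), inv_mul_cancel₀ h]

lemma en_scale (M : Matrix ι ι' ℝ) (x : ι' → ℝ) :
    euclNorm (M *ᵥ ((euclNorm x)⁻¹ • x)) = (euclNorm x)⁻¹ * euclNorm (M *ᵥ x) := by
  rw [Matrix.mulVec_smul, en_smul, abs_of_nonneg (inv_nonneg.2 (en_nonneg _))]

lemma spec_le (M : Matrix ι ι' ℝ) (x : ι' → ℝ) :
    euclNorm (M *ᵥ x) ≤ specNorm M * euclNorm x := by
  by_cases h : euclNorm x = 0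
  · rw [en_eq_zero h]; simp [en_zero]
  · have hp : 0 < euclNorm x := lt_of_le_of_ne (en_nonneg _) (Ne.symm h)
    have := le_csSup (spec_bdd M) ⟨_, (en_unit h).le, rfl⟩
    rw [en_scale] at this
    change _ ≤ specNorm M at this
    rwa [inv_mul_le_iff₀ hp, mul_comm] at this

lemma spec_le_t (M : Matrix ι ι' ℝ) (y : ι → ℝ) :
    euclNorm (Mᵀ *ᵥ y) ≤ specNorm M * euclNorm y := by
  have h1 := en_sq (Mᵀ *ᵥ y)
  rw [← dot_mulVec_t] at h1
  have h2 := dot_le (M *ᵥ (Mᵀ *ᵥ y)) y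
  have h3 := spec_le M (Mᵀ *ᵥ y)
  have h4 := en_nonneg y
  have h5 := en_nonneg (Mᵀ *ᵥ y)
  by_cases h : euclNorm (Mᵀ *ᵥ y) = 0
  · rw [h]; exact mul_nonneg (spec_nonneg _) h4
  · have hp : 0 < euclNorm (Mᵀ *ᵥ y) := lt_of_le_of_ne h5 (Ne.symm h)
    refine le_of_mul_le_mul_left ?_ hp
    have := mul_le_mul_of_nonneg_right h3 h4
    nlinarith

/-- transposing a lower bound for square matrices -/
lemma lower_t [DecidableEq ι] (N : Matrix ι ι ℝ) {s : ℝ} (hs : 0 < s)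
    (h : ∀ x, s * euclNorm x ≤ euclNorm (N *ᵥ x)) (y : ι → ℝ) :
    s * euclNorm y ≤ euclNorm (Nᵀ *ᵥ y) := by
  have hinj : Function.Injective N.mulVec := by
    intro a b hab
    have h0 : N *ᵥ (a - b) = 0 := by
      rw [Matrix.mulVec_sub]; exact sub_eq_zero.2 hab
    have h1 := h (a - b)
    rw [h0, en_zero] at h1
    have : euclNorm (a - b) = 0 := by
      have := en_nonneg (a - b)
      nlinarith
    exact sub_eq_zero.1 (en_eq_zero this)
  have hu : IsUnit N := Matrix.mulVec_injective_iff_isUnit.1 hinj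
  obtain ⟨x, hx⟩ := (Matrix.mulVec_surjective_iff_isUnit.2 hu) y
  subst hx
  have h1 := en_sq (N *ᵥ x)
  rw [dot_mulVec_t] at h1
  have h2 := dot_le x (Nᵀ *ᵥ (N *ᵥ x))
  have h3 := h x
  have h5 := en_nonneg (N *ᵥ x)
  by_cases h0 : euclNorm (N *ᵥ x) = 0
  · rw [h0]; simpa using en_nonneg _
  · have hp : 0 < euclNorm (N *ᵥ x) := lt_of_le_of_ne h5 (Ne.symm h0)
    refine le_of_mul_le_mul_left ?_ hp
    have := mul_le_mul_of_nonneg_right h3 (en_nonneg (Nᵀ *ᵥ (N *ᵥ x)))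
    nlinarith

lemma inf_bdd (M : Matrix ι ι' ℝ) :
    BddBelow {c : ℝ | ∃ x : ι' → ℝ, euclNorm x = 1 ∧ c = euclNorm (M.mulVec x)} := by
  refine ⟨0, ?_⟩
  rintro c ⟨x, hx, rfl⟩
  exact en_nonneg _

lemma inf_le (M : Matrix ι ι' ℝ) (x : ι' → ℝ) :
    sInf {c : ℝ | ∃ x : ι' → ℝ, euclNorm x = 1 ∧ c = euclNorm (M.mulVec x)} * euclNorm x
      ≤ euclNorm (M *ᵥ x) := by
  by_cases h : euclNorm x = 0
  · rw [h]; simpa using en_nonneg _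
  · have hp : 0 < euclNorm x := lt_of_le_of_ne (en_nonneg _) (Ne.symm h)
    have := csInf_le (inf_bdd M) ⟨_, (en_unit h), rfl⟩
    rw [en_scale] at this
    rwa [le_inv_mul_iff₀ hp, mul_comm] at this

lemma le_inf [Nonempty ι'] (M : Matrix ι ι' ℝ) {s : ℝ}
    (h : ∀ x, euclNorm x = 1 → s ≤ euclNorm (M *ᵥ x)) :
    s ≤ sInf {c : ℝ | ∃ x : ι' → ℝ, euclNorm x = 1 ∧ c = euclNorm (M.mulVec x)} := by
  classical
  apply le_csInf
  · obtain ⟨i⟩ := ‹Nonempty ι'›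
    refine ⟨_, Pi.single i 1, ?_, rfl⟩
    have := en_sq (Pi.single i (1:ℝ) : ι' → ℝ)
    simp at this
    rcases this with h | h
    · exact h
    · have := en_nonneg (Pi.single i (1:ℝ) : ι' → ℝ); linarith
  · rintro c ⟨x, hx, rfl⟩
    exact h x hx

lemma sigmaMin_nonneg (M : Matrix ι ι' ℝ) : 0 ≤ sigmaMin M := by
  apply le_max_of_le_left
  apply Real.sInf_nonneg
  rintro c ⟨x, hx, rfl⟩
  exact en_nonneg _

lemma le_sigmaMin_left [Nonempty ι'] (M : Matrix ι ι' ℝ) {s : ℝ}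
    (h : ∀ x, euclNorm x = 1 → s ≤ euclNorm (M *ᵥ x)) : s ≤ sigmaMin M :=
  le_max_of_le_left (le_inf M h)

lemma le_sigmaMin_right [Nonempty ι] (M : Matrix ι ι' ℝ) {s : ℝ}
    (h : ∀ x, euclNorm x = 1 → s ≤ euclNorm (Mᵀ *ᵥ x)) : s ≤ sigmaMin M :=
  le_max_of_le_right (le_inf Mᵀ h)

lemma sigmaMin_le {r k : ℕ} (hrk : r ≤ k) (M : Matrix (Fin r) (Fin k) ℝ) (y : Fin r → ℝ) :
    sigmaMin M * euclNorm y ≤ euclNorm (Mᵀ *ᵥ y) := by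
  rcases le_total (sInf {c : ℝ | ∃ x : Fin k → ℝ, euclNorm x = 1 ∧ c = euclNorm (M.mulVec x)})
    (sInf {c : ℝ | ∃ y : Fin r → ℝ, euclNorm y = 1 ∧ c = euclNorm (Mᵀ.mulVec y)}) with h | h
  · unfold sigmaMin
    rw [max_eq_right h]
    exact inf_le Mᵀ y
  · have h' := inf_le M
    unfold sigmaMin
    rw [max_eq_left h]
    set s := sInf {c : ℝ | ∃ x : Fin k → ℝ, euclNorm x = 1 ∧ c = euclNorm (M.mulVec x)} with hs
    rcases le_or_gt s 0 with h0 | h0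
    · exact (mul_nonpos_of_nonpos_of_nonneg h0 (en_nonneg _)).trans (en_nonneg _)
    · have hinj : Function.Injective M.mulVecLin := by
        intro a b hab
        have hz : M *ᵥ (a - b) = 0 := by
          rw [Matrix.mulVec_sub]; exact sub_eq_zero.2 hab
        have h1 := h' (a - b)
        rw [hz, en_zero] at h1
        have : euclNorm (a - b) = 0 := by
          have := en_nonneg (a - b)
          nlinarith
        exact sub_eq_zero.1 (en_eq_zero this)
      have := LinearMap.finrank_le_finrank_of_injective hinj
      simp at this
      obtain rfl : r = k := le_antisymm hrk this
      exact lower_t M h0 h' y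

/-- matrices with orthonormal columns are isometric -/
lemma en_iso [DecidableEq ι'] {U : Matrix ι ι' ℝ} (hU : Uᵀ * U = 1) (x : ι' → ℝ) :
    euclNorm (U *ᵥ x) = euclNorm x := by
  apply en_eq_of_sq
  rw [dot_mulVec_t, Matrix.mulVec_mulVec, hU, Matrix.one_mulVec]

lemma en_iso_t [DecidableEq ι'] {U : Matrix ι ι' ℝ} (hU : Uᵀ * U = 1) (x : ι → ℝ) :
    euclNorm (Uᵀ *ᵥ x) ≤ euclNorm x := by
  have h1 := en_sq (Uᵀ *ᵥ x)
  rw [← dot_mulVec_t] at h1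
  have h2 := dot_le (U *ᵥ (Uᵀ *ᵥ x)) x
  rw [en_iso hU] at h2
  have := en_nonneg x
  have := en_nonneg (Uᵀ *ᵥ x)
  nlinarith

end aux

lemma card_le_of_orth {a b : ℕ} {Q : Matrix (Fin a) (Fin b) ℝ} (h : Qᵀ * Q = 1) : b ≤ a := by
  have hinj : Function.Injective Q.mulVecLin := by
    intro x y hxy
    have hxy' : Q *ᵥ x = Q *ᵥ y := hxy
    have := congrArg (fun v => Qᵀ *ᵥ v) hxy'
    simpa [Matrix.mulVec_mulVec, h] using this
  have := LinearMap.finrank_le_finrank_of_injective hinj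
  simpa using this

lemma orth_complete {ι : Type*} [Fintype ι] [DecidableEq ι] {r p : ℕ}
    (hcard : Fintype.card ι = r + p)
    {U : Matrix ι (Fin r) ℝ} {V : Matrix ι (Fin p) ℝ} (hU : Uᵀ * U = 1) (hV : Vᵀ * V = 1)
    (hUV : Uᵀ * V = 0) : U * Uᵀ + V * Vᵀ = 1 := by
  have hVU : Vᵀ * U = 0 := by
    have := congrArg Matrix.transpose hUV
    simpa using this
  have h1 : (Matrix.fromRows Uᵀ Vᵀ) * (Matrix.fromCols U V) = 1 := by
    rw [Matrix.fromRows_mul_fromCols, hU, hV, hUV, hVU, Matrix.fromBlocks_one]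
  have h2 := (Matrix.mul_eq_one_comm_of_card_eq _ _ _ (by simp [hcard])).1 h1
  rwa [Matrix.fromCols_mul_fromRows] at h2

section iterfacts

variable {n₁ n₂ m k r : ℕ}

lemma BstarB_symMat (A : Fin m → Matrix (Fin n₁) (Fin n₂) ℝ) (M : Matrix (Fin n₁) (Fin n₂) ℝ) :
    BstarB A (symMat M) = symMat (AstarA A M) := by
  have h2 : (Real.sqrt 2)⁻¹ * (Real.sqrt 2)⁻¹ = 1 / 2 := by
    rw [← mul_inv, Real.mul_self_sqrt (by norm_num)]; norm_num
  have hin : ∀ i, minner (Bmat A i) (symMat M) = (Real.sqrt 2)⁻¹ * (2 * minner (A i) M) := by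
    intro i
    unfold minner Bmat symMat
    simp only [Fintype.sum_sum_type, Matrix.smul_apply, Matrix.fromBlocks_apply₁₁,
      Matrix.fromBlocks_apply₁₂, Matrix.fromBlocks_apply₂₁, Matrix.fromBlocks_apply₂₂,
      Matrix.zero_apply, Matrix.transpose_apply, smul_eq_mul, mul_zero, Finset.sum_const_zero,
      zero_add, add_zero]
    rw [Finset.sum_comm (s := (Finset.univ : Finset (Fin n₂)))]
    simp only [mul_assoc, ← Finset.mul_sum]
    ring
  have hterm : ∀ i, minner (Bmat A i) (symMat M) • Bmat A i
      = symMat (minner (A i) M • A i) := by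
    intro i
    rw [hin]
    unfold Bmat symMat
    rw [smul_smul, show (Real.sqrt 2)⁻¹ * (2 * minner (A i) M) * (Real.sqrt 2)⁻¹
      = ((Real.sqrt 2)⁻¹ * (Real.sqrt 2)⁻¹) * (2 * minner (A i) M) by ring, h2,
      show (1 / 2 : ℝ) * (2 * minner (A i) M) = minner (A i) M by ring,
      Matrix.fromBlocks_smul]
    simp
  unfold BstarB AstarA
  simp only [hterm]
  ext i j
  rcases i with i | i <;> rcases j with j | j <;>
    simp [symMat, Matrix.sum_apply]

lemma Ztil_eq (A : Fin m → Matrix (Fin n₁) (Fin n₂) ℝ) (X : Matrix (Fin n₁) (Fin n₂) ℝ)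
    (μ : ℝ) (V₀ : Matrix (Fin n₁) (Fin k) ℝ) (W₀ : Matrix (Fin n₂) (Fin k) ℝ) (t : ℕ) :
    Ztil A X μ V₀ W₀ t = flipSign n₁ n₂ * Zit A X μ V₀ W₀ t := by
  unfold Ztil Zit Zstack flipSign
  rw [Matrix.mul_smul, Matrix.fromBlocks_mul_fromRows]
  simp

lemma flip_orth : (flipSign n₁ n₂)ᵀ * flipSign n₁ n₂ = 1 := by
  unfold flipSign
  simp [Matrix.fromBlocks_transpose, Matrix.fromBlocks_multiply, Matrix.fromBlocks_one]

lemma inv_sqrt_two : (Real.sqrt 2)⁻¹ * (Real.sqrt 2)⁻¹ = 1 / 2 := by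
  rw [← mul_inv, Real.mul_self_sqrt (by norm_num)]; norm_num

lemma D_eq (V : Matrix (Fin n₁) (Fin k) ℝ) (W : Matrix (Fin n₂) (Fin k) ℝ)
    (X : Matrix (Fin n₁) (Fin n₂) ℝ) :
    Zstack V W * (Zstack V W)ᵀ - Zstack V (-W) * (Zstack V (-W))ᵀ - symMat X
      = symMat (V * Wᵀ - X) := by
  unfold Zstack symMat
  simp only [Matrix.transpose_smul, Matrix.smul_mul, Matrix.mul_smul, smul_smul, inv_sqrt_two,
    Matrix.transpose_fromRows, Matrix.fromRows_mul_fromCols]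
  ext i j
  rcases i with i | i <;> rcases j with j | j <;>
    simp <;> ring

lemma sym_mul_Zstack (G : Matrix (Fin n₁) (Fin n₂) ℝ)
    (V : Matrix (Fin n₁) (Fin k) ℝ) (W : Matrix (Fin n₂) (Fin k) ℝ) :
    symMat G * Zstack V W = Zstack (G * W) (Gᵀ * V) := by
  unfold Zstack symMat
  rw [Matrix.mul_smul, Matrix.fromBlocks_mul_fromRows]
  simp

lemma Zit_succ (A : Fin m → Matrix (Fin n₁) (Fin n₂) ℝ) (X : Matrix (Fin n₁) (Fin n₂) ℝ)
    (μ : ℝ) (V₀ : Matrix (Fin n₁) (Fin k) ℝ) (W₀ : Matrix (Fin n₂) (Fin k) ℝ) (t : ℕ) :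
    Zit A X μ V₀ W₀ (t + 1) = Zit A X μ V₀ W₀ t - μ •
      ((Zit A X μ V₀ W₀ t * (Zit A X μ V₀ W₀ t)ᵀ - Ztil A X μ V₀ W₀ t * (Ztil A X μ V₀ W₀ t)ᵀ
        - symMat X - Δit A X μ V₀ W₀ t) * Zit A X μ V₀ W₀ t) := by
  unfold Δit
  dsimp only
  rw [sub_sub_cancel]
  unfold Zit Ztil
  rw [D_eq, BstarB_symMat, sym_mul_Zstack]
  simp only [iter]
  unfold Zstack
  ext i j
  rcases i with i | i <;> simp <;> ring

lemma LX_orth {PX : Matrix (Fin n₁) (Fin r) ℝ} {QX : Matrix (Fin n₂) (Fin r) ℝ}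
    (hPX : PXᵀ * PX = 1) (hQX : QXᵀ * QX = 1) : (Zstack PX QX)ᵀ * Zstack PX QX = 1 := by
  unfold Zstack
  rw [Matrix.transpose_smul, Matrix.smul_mul, Matrix.mul_smul, smul_smul, inv_sqrt_two,
    Matrix.transpose_fromRows, Matrix.fromCols_mul_fromRows, hPX, hQX, ← two_smul ℝ, smul_smul]
  norm_num

lemma LX_sym {PX : Matrix (Fin n₁) (Fin r) ℝ} {QX : Matrix (Fin n₂) (Fin r) ℝ} {σX : Fin r → ℝ}
    {X : Matrix (Fin n₁) (Fin n₂) ℝ}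
    (hPX : PXᵀ * PX = 1) (hQX : QXᵀ * QX = 1)
    (hXsvd : X = PX * Matrix.diagonal σX * QXᵀ) :
    symMat X * Zstack PX QX = Zstack PX QX * Matrix.diagonal σX := by
  rw [sym_mul_Zstack, hXsvd]
  simp only [Matrix.transpose_mul, Matrix.transpose_transpose, Matrix.diagonal_transpose]
  have h1 : PX * Matrix.diagonal σX * QXᵀ * QX = PX * Matrix.diagonal σX := by
    rw [Matrix.mul_assoc _ QXᵀ, hQX, Matrix.mul_one]
  have h2 : QX * (Matrix.diagonal σX * PXᵀ) * PX = QX * Matrix.diagonal σX := by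
    rw [Matrix.mul_assoc, Matrix.mul_assoc _ PXᵀ, hPX, Matrix.mul_one]
  rw [h1, h2]
  unfold Zstack
  rw [Matrix.smul_mul, Matrix.fromRows_mul]

lemma en_single {p : ℕ} (i : Fin p) : euclNorm (Pi.single i (1:ℝ) : Fin p → ℝ) = 1 := by
  have := en_sq (Pi.single i (1:ℝ) : Fin p → ℝ)
  have h0 := en_nonneg (Pi.single i (1:ℝ) : Fin p → ℝ)
  simp at this
  rcases this with h | h
  · exact h
  · linarith

lemma sigma_facts {PX : Matrix (Fin n₁) (Fin r) ℝ} {QX : Matrix (Fin n₂) (Fin r) ℝ}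
    {σX : Fin r → ℝ} {X : Matrix (Fin n₁) (Fin n₂) ℝ}
    (hPX : PXᵀ * PX = 1) (hQX : QXᵀ * QX = 1) (hσpos : ∀ i, 0 < σX i)
    (hXsvd : X = PX * Matrix.diagonal σX * QXᵀ) (i : Fin r) :
    sigmaPos X ≤ σX i ∧ σX i ≤ specNorm X := by
  set x := QX *ᵥ (Pi.single i (1:ℝ)) with hx
  have hx1 : euclNorm x = 1 := by rw [hx, en_iso hQX, en_single]
  have hXx : X *ᵥ x = PX *ᵥ (σX i • Pi.single i (1:ℝ)) := by
    rw [hx, hXsvd, Matrix.mulVec_mulVec, Matrix.mul_assoc _ QXᵀ, hQX, Matrix.mul_one,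
      ← Matrix.mulVec_mulVec]
    congr 1
    ext j
    by_cases h : j = i
    · subst h; simp
    · simp [h]
  have hn : euclNorm (X *ᵥ x) = σX i := by
    rw [hXx, en_iso hPX, en_smul, en_single, abs_of_pos (hσpos i), mul_one]
  constructor
  · refine csInf_le ⟨0, ?_⟩ ⟨x, hx1, ?_, hn.symm⟩
    · rintro c ⟨x, _, _, rfl⟩
      exact en_nonneg _
    · intro y hy
      have h1 : Matrix.diagonal σX *ᵥ (QXᵀ *ᵥ y) = 0 := by
        have := congrArg (fun v => PXᵀ *ᵥ v) hy
        simp only [hXsvd, Matrix.mulVec_mulVec, Matrix.mulVec_zero] at this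
        rwa [Matrix.mul_assoc PX, ← Matrix.mul_assoc PXᵀ, hPX, Matrix.one_mul,
          ← Matrix.mulVec_mulVec] at this
      rw [hx, dot_mulVec_t]
      have h2 := congrFun h1 i
      rw [Matrix.mulVec_diagonal] at h2
      have h3 : (QXᵀ *ᵥ y) i = 0 := by
        rcases mul_eq_zero.1 h2 with h | h
        · exact absurd h (hσpos i).ne'
        · exact h
      simp [h3]
  · have := spec_le X x
    rw [hn, hx1] at this
    linarith

end iterfacts

lemma mv_sq {ι ι' : Type*} [Fintype ι] [Fintype ι'] (Z : Matrix ι ι' ℝ) (g u : ι → ℝ) :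
    ((Z * Zᵀ) *ᵥ g) ⬝ᵥ u = (Zᵀ *ᵥ g) ⬝ᵥ (Zᵀ *ᵥ u) := by
  rw [← Matrix.mulVec_mulVec, dot_mulVec_t]

lemma core_step {ι : Type*} [Fintype ι] {k r : ℕ}
    {S Δ : Matrix ι ι ℝ} {Z Z' Z1 : Matrix ι (Fin k) ℝ} {U : Matrix ι (Fin r) ℝ}
    {Q : Matrix (Fin k) (Fin r) ℝ} {σX : Fin r → ℝ} {μ N σ b : ℝ}
    (hU : Uᵀ * U = 1) (hQ : Qᵀ * Q = 1) (hS : Sᵀ = S) (hSU : S * U = U * Matrix.diagonal σX)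
    (hσX : ∀ i, σ ≤ σX i) (hμ : 0 < μ) (hσ : 0 < σ) (hb0 : 0 ≤ b) (hb : b ^ 2 = 4 * N)
    (hZ : ∀ y, euclNorm (Zᵀ *ᵥ y) ≤ b * euclNorm y)
    (hZ' : ∀ y, euclNorm (Z'ᵀ *ᵥ y) ≤ b * euclNorm y)
    (hΔ : ∀ y, euclNorm (Δ *ᵥ y) ≤ (1 / 100 * σ) * euclNorm y)
    (hZ1 : Z1 = Z - μ • ((Z * Zᵀ - Z' * Z'ᵀ - S - Δ) * Z))
    (hQ2 : Uᵀ * Z * Q * Qᵀ = Uᵀ * Z) (x : Fin r → ℝ)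
    (he : N * euclNorm ((Z * Q) *ᵥ x - U *ᵥ ((Uᵀ * Z * Q) *ᵥ x))
      ≤ 2 * (1 / 100) * σ * euclNorm ((Uᵀ * Z * Q) *ᵥ x))
    (hg : euclNorm ((Z * Q) *ᵥ x) ≤ 2 * euclNorm ((Uᵀ * Z * Q) *ᵥ x)) :
    euclNorm ((Uᵀ * Z * Q) *ᵥ x) ^ 2 * (1 + μ * σ / 4)
        - μ * euclNorm ((Uᵀ * Z * Q)ᵀ *ᵥ ((Uᵀ * Z * Q) *ᵥ x)) ^ 2
      ≤ ((Uᵀ * Z1 * Q) *ᵥ x) ⬝ᵥ ((Uᵀ * Z * Q) *ᵥ x) := by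
  set H := Uᵀ * Z * Q with hH
  set h := H *ᵥ x with hh
  set g := (Z * Q) *ᵥ x with hgdef
  set u := U *ᵥ h with hu
  set e := g - u with hedef
  have hUg : Uᵀ *ᵥ g = h := by
    rw [hgdef, hh, hH, Matrix.mulVec_mulVec, Matrix.mul_assoc]
  have hnu : euclNorm u = euclNorm h := en_iso hU h
  have hge : g = u + e := by rw [hedef]; abel
  -- the term ZZᵀ
  have hZu : Zᵀ *ᵥ u = Q *ᵥ (Hᵀ *ᵥ h) := by
    have hm : Zᵀ * U = Q * Hᵀ := by
      have := congrArg Matrix.transpose hQ2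
      rw [Matrix.transpose_mul, Matrix.transpose_transpose] at this
      rw [this, Matrix.transpose_mul, Matrix.transpose_transpose]
    rw [hu, Matrix.mulVec_mulVec h, hm, ← Matrix.mulVec_mulVec]
  have t1 : ((Z * Zᵀ) *ᵥ g) ⬝ᵥ u ≤ euclNorm (Hᵀ *ᵥ h) ^ 2 + 8 / 100 * σ * euclNorm h ^ 2 := by
    rw [mv_sq, hge, Matrix.mulVec_add, add_dotProduct, ← en_sq]
    have h1 : euclNorm (Zᵀ *ᵥ u) = euclNorm (Hᵀ *ᵥ h) := by rw [hZu, en_iso hQ]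
    rw [h1]
    have h2 := dot_le (Zᵀ *ᵥ e) (Zᵀ *ᵥ u)
    have h3 := mul_le_mul (hZ e) (hZ u) (en_nonneg _) (mul_nonneg hb0 (en_nonneg _))
    rw [hnu] at h3
    have h4 := mul_le_mul_of_nonneg_right he (en_nonneg h)
    have h5 : b * euclNorm e * (b * euclNorm h) = 4 * (N * euclNorm e * euclNorm h) := by
      linear_combination (euclNorm e * euclNorm h) * hb
    nlinarith
  have t2 : -(8 / 100 * σ * euclNorm h ^ 2) ≤ ((Z' * Z'ᵀ) *ᵥ g) ⬝ᵥ u := by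
    rw [mv_sq, hge, Matrix.mulVec_add, add_dotProduct, ← en_sq]
    have h2 := (abs_le.1 (abs_dot_le (Z'ᵀ *ᵥ e) (Z'ᵀ *ᵥ u))).1
    have h3 := mul_le_mul (hZ' e) (hZ' u) (en_nonneg _) (mul_nonneg hb0 (en_nonneg _))
    rw [hnu] at h3
    have h4 := mul_le_mul_of_nonneg_right he (en_nonneg h)
    have h5 : b * euclNorm e * (b * euclNorm h) = 4 * (N * euclNorm e * euclNorm h) := by
      linear_combination (euclNorm e * euclNorm h) * hb
    nlinarith [sq_nonneg (euclNorm (Z'ᵀ *ᵥ u))]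
  have t3 : σ * euclNorm h ^ 2 ≤ (S *ᵥ g) ⬝ᵥ u := by
    rw [dot_mulVec_t, hS, hu, Matrix.mulVec_mulVec, hSU, ← Matrix.mulVec_mulVec,
      dotProduct_comm, dot_mulVec_t, hUg, en_sq]
    simp only [dotProduct, Matrix.mulVec_diagonal, Finset.mul_sum]
    apply Finset.sum_le_sum
    intro i _
    nlinarith [hσX i, mul_self_nonneg (h i)]
  have t4 : -(2 / 100 * σ * euclNorm h ^ 2) ≤ (Δ *ᵥ g) ⬝ᵥ u := by
    have h2 := (abs_le.1 (abs_dot_le (Δ *ᵥ g) u)).1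
    rw [hnu] at h2
    have h3 : euclNorm (Δ *ᵥ g) ≤ 2 / 100 * σ * euclNorm h := by
      have := hΔ g
      nlinarith
    have := mul_le_mul_of_nonneg_right h3 (en_nonneg h)
    nlinarith
  have hmain : ((Uᵀ * Z1 * Q) *ᵥ x) ⬝ᵥ h = euclNorm h ^ 2 - μ * (((Z * Zᵀ) *ᵥ g) ⬝ᵥ u
      - ((Z' * Z'ᵀ) *ᵥ g) ⬝ᵥ u - (S *ᵥ g) ⬝ᵥ u - (Δ *ᵥ g) ⬝ᵥ u) := by
    have h1 : (Uᵀ * Z1 * Q) *ᵥ x = Uᵀ *ᵥ (g - μ • ((Z * Zᵀ) *ᵥ g - (Z' * Z'ᵀ) *ᵥ g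
        - S *ᵥ g - Δ *ᵥ g)) := by
      rw [← Matrix.sub_mulVec, ← Matrix.sub_mulVec, ← Matrix.sub_mulVec, hgdef, hZ1,
        Matrix.mulVec_mulVec, ← Matrix.smul_mulVec, ← Matrix.sub_mulVec, Matrix.mulVec_mulVec,
        Matrix.mul_assoc Uᵀ, Matrix.sub_mul, Matrix.smul_mul, Matrix.mul_assoc _ Z Q]
    rw [h1, dot_mulVec_t, Matrix.transpose_transpose, ← hu, sub_dotProduct, smul_dotProduct,
      sub_dotProduct, sub_dotProduct, sub_dotProduct, smul_eq_mul]
    congr 1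
    rw [hu, dotProduct_comm, dot_mulVec_t, hUg, en_sq]
  rw [hmain]
  have hm := sq_nonneg (euclNorm h)
  have : ((Z * Zᵀ) *ᵥ g) ⬝ᵥ u - ((Z' * Z'ᵀ) *ᵥ g) ⬝ᵥ u - (S *ᵥ g) ⬝ᵥ u - (Δ *ᵥ g) ⬝ᵥ u
      ≤ euclNorm (Hᵀ *ᵥ h) ^ 2 - σ / 4 * euclNorm h ^ 2 := by
    nlinarith [mul_nonneg hσ.le hm]
  have := mul_le_mul_of_nonneg_left this hμ.le
  nlinarith

/-- If `H ≥ s` and `‖H‖² ≤ a`, then `‖HᵀHx‖²` is controlled. -/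
lemma moment {r : ℕ} (H : Matrix (Fin r) (Fin r) ℝ) {s a : ℝ} (ha : 0 < a)
    (hlow : ∀ x, s * euclNorm x ≤ euclNorm (H *ᵥ x)) (hs : 0 ≤ s)
    (hup : ∀ x, euclNorm (H *ᵥ x) ^ 2 ≤ a * euclNorm x ^ 2)
    (x : Fin r → ℝ) (hx : euclNorm x = 1) :
    euclNorm (Hᵀ *ᵥ (H *ᵥ x)) ^ 2
      ≤ 2 * a * (euclNorm (H *ᵥ x) ^ 2 - s ^ 2) + s ^ 2 * euclNorm (H *ᵥ x) ^ 2 := by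
  set w := Hᵀ *ᵥ (H *ᵥ x) with hw
  set z := w - s ^ 2 • x with hz
  -- squared lower bound
  have hsq : ∀ y, s ^ 2 * euclNorm y ^ 2 ≤ euclNorm (H *ᵥ y) ^ 2 := by
    intro y
    rw [← mul_pow]
    exact pow_le_pow_left₀ (mul_nonneg hs (en_nonneg _)) (hlow y) 2
  have hxx : x ⬝ᵥ x = 1 := by rw [← en_sq, hx]; norm_num
  have hwx : x ⬝ᵥ w = euclNorm (H *ᵥ x) ^ 2 := by rw [hw, ← dot_mulVec_t, en_sq]
  have hzz : z ⬝ᵥ z = euclNorm w ^ 2 - 2 * s ^ 2 * euclNorm (H *ᵥ x) ^ 2 + s ^ 4 := by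
    rw [hz, sub_dotProduct, dotProduct_sub, dotProduct_sub, smul_dotProduct, smul_dotProduct,
      dotProduct_smul, dotProduct_smul, dotProduct_comm w x, hwx, hxx, en_sq w]
    simp only [smul_eq_mul]; ring
  have hzw : z ⬝ᵥ w - s ^ 2 * (z ⬝ᵥ x) = z ⬝ᵥ z := by
    conv_rhs => rw [hz, dotProduct_sub, ← hz, dotProduct_smul, smul_eq_mul]
  have key := hsq (x - a⁻¹ • z)
  have e1 : euclNorm (x - a⁻¹ • z) ^ 2 = 1 - 2 * a⁻¹ * (z ⬝ᵥ x) + a⁻¹ ^ 2 * (z ⬝ᵥ z) := by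
    rw [en_sq, sub_dotProduct, dotProduct_sub, dotProduct_sub, smul_dotProduct, smul_dotProduct,
      dotProduct_smul, dotProduct_smul, dotProduct_comm x z, hxx]
    simp only [smul_eq_mul]; ring
  have e2 : euclNorm (H *ᵥ (x - a⁻¹ • z)) ^ 2 = euclNorm (H *ᵥ x) ^ 2 - 2 * a⁻¹ * (z ⬝ᵥ w)
      + a⁻¹ ^ 2 * euclNorm (H *ᵥ z) ^ 2 := by
    have : (H *ᵥ z) ⬝ᵥ (H *ᵥ x) = z ⬝ᵥ w := by rw [dot_mulVec_t]
    rw [Matrix.mulVec_sub, Matrix.mulVec_smul, en_sq, sub_dotProduct, dotProduct_sub,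
      dotProduct_sub, smul_dotProduct, smul_dotProduct,
      dotProduct_smul, dotProduct_smul, dotProduct_comm (H *ᵥ x) (H *ᵥ z), this, en_sq, en_sq]
    simp only [smul_eq_mul]; ring
  have hHz := hup z
  rw [en_sq z] at hHz
  have hzz0 : 0 ≤ z ⬝ᵥ z := by rw [← en_sq]; positivity
  rw [e1, e2] at key
  have hd : 0 ≤ euclNorm (H *ᵥ x) ^ 2 - s ^ 2 := by
    have := hsq x
    rw [hx] at this
    linarith
  have hsa : s ^ 2 ≤ a := by
    have h1 := hsq x
    have h2 := hup x
    rw [hx] at h1 h2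
    linarith
  have hai : 0 < a⁻¹ := inv_pos.2 ha
  -- ‖z‖² ≤ a (‖Hx‖² - s²)
  have hfin : z ⬝ᵥ z ≤ a * (euclNorm (H *ᵥ x) ^ 2 - s ^ 2) := by
    have h1 : a⁻¹ ^ 2 * euclNorm (H *ᵥ z) ^ 2 ≤ a⁻¹ * (z ⬝ᵥ z) := by
      have := mul_le_mul_of_nonneg_left hHz (sq_nonneg a⁻¹)
      calc _ ≤ _ := this
        _ = a⁻¹ * (z ⬝ᵥ z) := by field_simp
    have h2 : 0 ≤ s ^ 2 * (a⁻¹ ^ 2 * (z ⬝ᵥ z)) := by positivity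
    have h3 : a⁻¹ * (z ⬝ᵥ w) = a⁻¹ * (z ⬝ᵥ z) + s ^ 2 * (a⁻¹ * (z ⬝ᵥ x)) := by
      rw [← hzw]; ring
    have h4 : a⁻¹ * (z ⬝ᵥ z) ≤ euclNorm (H *ᵥ x) ^ 2 - s ^ 2 := by
      nlinarith
    rwa [inv_mul_le_iff₀ ha] at h4
  nlinarith [mul_le_mul_of_nonneg_right hsa hd]

lemma scalar_final {m s μ σ a W D : ℝ} (hs : 0 < s) (hms : s ≤ m) (hμ : 0 < μ) (hσ : 0 < σ)
    (hμa : μ * a ≤ 1 / 25) (hsa : s ^ 2 ≤ a)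
    (hW : W ≤ 2 * a * (m ^ 2 - s ^ 2) + s ^ 2 * m ^ 2)
    (hD : m ^ 2 * (1 + μ * σ / 4) - μ * W ≤ D * m) :
    s * (1 + μ * σ / 4 - μ * s ^ 2) ≤ D := by
  have hm : 0 < m := hs.trans_le hms
  refine le_of_mul_le_mul_right ?_ hm
  refine le_trans ?_ hD
  have h1 := mul_le_mul_of_nonneg_left hW hμ.le
  have h2 : μ * s ^ 2 ≤ 1 / 25 := (mul_le_mul_of_nonneg_left hsa hμ.le).trans hμa
  have hd : 0 ≤ m - s := sub_nonneg.2 hms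
  have h3 : 0 ≤ μ * σ := (mul_pos hμ hσ).le
  have h4 : μ * a * (m ^ 2 - s ^ 2) ≤ 1 / 25 * (2 * (m * (m - s))) := by
    have : 0 ≤ m ^ 2 - s ^ 2 := by nlinarith
    have := mul_le_mul_of_nonneg_right hμa this
    nlinarith
  have h5 : 0 ≤ (m * (m - s)) * (1 + μ * σ / 4 - μ * s ^ 2 - 4 / 25) := by
    apply mul_nonneg (mul_nonneg hm.le hd)
    linarith
  nlinarith

lemma sigmaMin_empty {k r : ℕ} (hr : r = 0) (M : Matrix (Fin r) (Fin k) ℝ) : sigmaMin M = 0 := by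
  subst hr
  refine le_antisymm ?_ (sigmaMin_nonneg M)
  apply max_le
  · apply Real.sInf_nonpos
    rintro c ⟨x, _, rfl⟩
    simp [euclNorm]
  · apply Real.sInf_nonpos
    rintro c ⟨x, hx, rfl⟩
    simp [euclNorm] at hx

/-- growth of `σ_min(L_XᵀZ_t)`. -/
theorem statement9_sigmin_growth :
    ∃ c : ℝ, 0 < c ∧
    ∀
    (n₁ n₂ m k r : ℕ)
    (A : Fin m → Matrix (Fin n₁) (Fin n₂) ℝ) (X : Matrix (Fin n₁) (Fin n₂) ℝ)
    (PX : Matrix (Fin n₁) (Fin r) ℝ) (QX : Matrix (Fin n₂) (Fin r) ℝ) (σX : Fin r → ℝ)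
    (hPX : PXᵀ * PX = 1) (hQX : QXᵀ * QX = 1)
    (hσpos : ∀ i, 0 < σX i) (hσanti : Antitone σX)
    (hXsvd : X = PX * Matrix.diagonal σX * QXᵀ)
    (μ : ℝ) (hμ : 0 < μ)
    (V₀ : Matrix (Fin n₁) (Fin k) ℝ) (W₀ : Matrix (Fin n₂) (Fin k) ℝ)
    (Z Z' : ℕ → Matrix (Fin n₁ ⊕ Fin n₂) (Fin k) ℝ)
    (hZ : Z = Zit A X μ V₀ W₀) (hZ' : Z' = Ztil A X μ V₀ W₀)
    (LX : Matrix (Fin n₁ ⊕ Fin n₂) (Fin r) ℝ) (hLX : LX = Zstack PX QX)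
    (κ σm : ℝ) (hκ : κ = condNum X) (hσm : σm = sigmaPos X)
    (Δ : ℕ → Matrix (Fin n₁ ⊕ Fin n₂) (Fin n₁ ⊕ Fin n₂) ℝ) (hΔ : Δ = Δit A X μ V₀ W₀)
    (LXp : Matrix (Fin n₁ ⊕ Fin n₂) (Fin (n₁ + n₂ - r)) ℝ)
    (hLXp1 : LXpᵀ * LXp = 1) (hLXp2 : LXᵀ * LXp = 0)
    (t : ℕ)
    (Qt : Matrix (Fin k) (Fin r) ℝ) (hQt1 : Qtᵀ * Qt = 1)
    (hQt2 : LXᵀ * Z t * Qt * Qtᵀ = LXᵀ * Z t)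
    (PZ : Matrix (Fin n₁ ⊕ Fin n₂) (Fin r) ℝ) (hPZ : IsOrthCol PZ (Z t * Qt))
    (h1 : μ ≤ c / (specNorm X * κ))
    (h2 : specNorm (Z t) ≤ 2 * Real.sqrt (specNorm X))
    (h3 : specNorm (LXpᵀ * PZ) ≤ c / κ)
    (h4 : specNorm (Δ t) ≤ c * σm)
    (h5 : IsUnit (LXᵀ * Z t * Qt)),
    sigmaMin (LXᵀ * Z t) * (1 + μ * σm / 4 - μ * sigmaMin (LXᵀ * Z t) ^ 2)
        ≤ sigmaMin (LXᵀ * Z (t + 1) * Qt) ∧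
    sigmaMin (LXᵀ * Z (t + 1) * Qt) ≤ sigmaMin (LXᵀ * Z (t + 1)) := by
  refine ⟨1 / 100, by norm_num, ?_⟩
  intro n₁ n₂ m k r A X PX QX σX hPX hQX hσpos hσanti hXsvd μ hμ V₀ W₀ Z Z' hZ hZ' LX hLX
    κ σm hκ hσm Δ hΔ LXp hLXp1 hLXp2 t Qt hQt1 hQt2 PZ hPZ h1 h2 h3 h4 h5
  rcases Nat.eq_zero_or_pos r with hr | hr
  · rw [sigmaMin_empty hr, sigmaMin_empty hr, sigmaMin_empty hr]
    simp
  have : Nonempty (Fin r) := ⟨⟨0, hr⟩⟩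
  have hrk : r ≤ k := card_le_of_orth hQt1
  have hLXo : LXᵀ * LX = 1 := by rw [hLX]; exact LX_orth hPX hQX
  constructor
  swap
  · -- second inequality
    apply le_sigmaMin_right
    intro y hy
    have ha := sigmaMin_le le_rfl (LXᵀ * Z (t + 1) * Qt) y
    rw [hy, mul_one] at ha
    refine ha.trans ?_
    rw [Matrix.transpose_mul, ← Matrix.mulVec_mulVec]
    exact en_iso_t hQt1 _
  -- basic facts on the constants
  set N := specNorm X with hN
  have hN0 : 0 ≤ N := spec_nonneg X
  have hσ0 : 0 ≤ σm := by
    rw [hσm]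
    apply Real.sInf_nonneg
    rintro c ⟨x, _, _, rfl⟩
    exact en_nonneg _
  have hκ' : κ = N / σm := by rw [hκ, hσm]; rfl
  have hσ : 0 < σm := by
    rcases hσ0.eq_or_lt with h | h
    · exfalso
      rw [hκ', ← h] at h1
      simp at h1
      linarith
    · exact h
  have hNpos : 0 < N := by
    rcases hN0.eq_or_lt with h | h
    · exfalso
      rw [← h] at h1
      simp at h1
      linarith
    · exact h
  have hfacts := sigma_facts hPX hQX hσpos hXsvd
  rw [← hσm, ← hN] at hfacts
  have hσN : σm ≤ N := (hfacts ⟨0, hr⟩).1.trans (hfacts ⟨0, hr⟩).2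
  have hμN : μ * (4 * N) ≤ 1 / 25 := by
    have e : (1 / 100 : ℝ) / (N * κ) = (1 / 100 * σm / N) / N := by
      rw [hκ']; field_simp
    rw [e, le_div_iff₀ hNpos] at h1
    have : 1 / 100 * σm / N ≤ 1 / 100 := by
      rw [div_le_iff₀ hNpos]; linarith
    linarith
  have hcκ : (1 / 100 : ℝ) / κ = 1 / 100 * σm / N := by
    rw [hκ']; field_simp
  rw [hcκ] at h3
  set ε := 1 / 100 * σm / N with hε
  have hε0 : 0 ≤ ε := by positivity
  have hε1 : ε ≤ 1 / 100 := by
    rw [hε, div_le_iff₀ hNpos]; linarith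
  have hεN : N * ε = 1 / 100 * σm := by rw [hε]; field_simp
  set b := 2 * Real.sqrt N with hb
  have hb0 : 0 ≤ b := by positivity
  have hb2 : b ^ 2 = 4 * N := by rw [hb, mul_pow, Real.sq_sqrt hN0]; norm_num
  have hZt : ∀ y, euclNorm ((Z t)ᵀ *ᵥ y) ≤ b * euclNorm y := fun y =>
    (spec_le_t (Z t) y).trans (mul_le_mul_of_nonneg_right h2 (en_nonneg _))
  have hZv : ∀ y, euclNorm (Z t *ᵥ y) ≤ b * euclNorm y := fun y =>
    (spec_le (Z t) y).trans (mul_le_mul_of_nonneg_right h2 (en_nonneg _))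
  have hZf : Z' t = flipSign n₁ n₂ * Z t := by rw [hZ', hZ, Ztil_eq]
  have hZt' : ∀ y, euclNorm ((Z' t)ᵀ *ᵥ y) ≤ b * euclNorm y := by
    intro y
    rw [hZf, Matrix.transpose_mul, ← Matrix.mulVec_mulVec]
    exact (hZt _).trans (mul_le_mul_of_nonneg_left (en_iso_t flip_orth y) hb0)
  have hΔt : ∀ y, euclNorm (Δ t *ᵥ y) ≤ (1 / 100 * σm) * euclNorm y := fun y =>
    (spec_le (Δ t) y).trans (mul_le_mul_of_nonneg_right h4 (en_nonneg _))
  have hSsym : (symMat X)ᵀ = symMat X := by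
    simp [symMat, Matrix.fromBlocks_transpose]
  have hSU : symMat X * LX = LX * Matrix.diagonal σX := by
    rw [hLX]; exact LX_sym hPX hQX hXsvd
  have hstep : Z (t + 1) = Z t - μ • ((Z t * (Z t)ᵀ - Z' t * (Z' t)ᵀ - symMat X - Δ t) * Z t) := by
    rw [hZ, hZ', hΔ]; exact Zit_succ A X μ V₀ W₀ t
  have hr' : r ≤ n₁ := card_le_of_orth hPX
  have hcomp : LX * LXᵀ + LXp * LXpᵀ = 1 := by
    apply orth_complete _ hLXo hLXp1 hLXp2
    simp
    omega
  obtain ⟨hPZ1, -, hPZ3⟩ := hPZ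
  set H := LXᵀ * Z t * Qt with hH
  set s := sigmaMin (LXᵀ * Z t) with hsdef
  have hs0 : 0 ≤ s := sigmaMin_nonneg _
  rcases hs0.eq_or_lt with hs | hs
  · rw [← hs, zero_mul]; exact sigmaMin_nonneg _
  -- lower bound for H
  have hlowt : ∀ y, s * euclNorm y ≤ euclNorm (Hᵀ *ᵥ y) := by
    intro y
    have ha := sigmaMin_le hrk (LXᵀ * Z t) y
    rw [← hQt2, Matrix.transpose_mul, Matrix.transpose_transpose, ← Matrix.mulVec_mulVec,
      en_iso hQt1, hQt2] at ha
    exact ha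
  have hlow : ∀ x, s * euclNorm x ≤ euclNorm (H *ᵥ x) := by
    intro x
    have := lower_t Hᵀ hs hlowt x
    rwa [Matrix.transpose_transpose] at this
  have hup : ∀ x, euclNorm (H *ᵥ x) ^ 2 ≤ (4 * N) * euclNorm x ^ 2 := by
    intro x
    have ha : euclNorm (H *ᵥ x) ≤ b * euclNorm x := by
      rw [hH, Matrix.mul_assoc, ← Matrix.mulVec_mulVec]
      refine (en_iso_t hLXo _).trans ?_
      rw [← Matrix.mulVec_mulVec]
      refine (hZv _).trans ?_
      rw [en_iso hQt1]
    have := pow_le_pow_left₀ (en_nonneg _) ha 2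
    rwa [mul_pow, hb2] at this
  apply le_sigmaMin_left
  intro x hx
  -- the decomposition of g
  set g := (Z t * Qt) *ᵥ x with hg
  have hUg : LXᵀ *ᵥ g = H *ᵥ x := by
    rw [hg, hH, Matrix.mulVec_mulVec, Matrix.mul_assoc]
  have hsplit : ∀ v, LX *ᵥ (LXᵀ *ᵥ v) + LXp *ᵥ (LXpᵀ *ᵥ v) = v := by
    intro v
    rw [Matrix.mulVec_mulVec, Matrix.mulVec_mulVec, ← Matrix.add_mulVec, hcomp,
      Matrix.one_mulVec]
  have hsplit2 : ∀ v, v ⬝ᵥ v = (LXᵀ *ᵥ v) ⬝ᵥ (LXᵀ *ᵥ v) + (LXpᵀ *ᵥ v) ⬝ᵥ (LXpᵀ *ᵥ v) := by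
    intro v
    rw [dot_mulVec_t LXᵀ, dot_mulVec_t LXpᵀ, ← dotProduct_add, Matrix.transpose_transpose,
      Matrix.transpose_transpose, hsplit]
  have hdec : g - LX *ᵥ (H *ᵥ x) = LXp *ᵥ (LXpᵀ *ᵥ g) := by
    rw [← hUg, sub_eq_iff_eq_add, add_comm]
    exact (hsplit g).symm
  have hgP : g = PZ *ᵥ (PZᵀ *ᵥ g) := by
    rw [Matrix.mulVec_mulVec, hg, Matrix.mulVec_mulVec, hPZ3]
  have hek : euclNorm (g - LX *ᵥ (H *ᵥ x)) ≤ ε * euclNorm g := by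
    rw [hdec, en_iso hLXp1]
    calc euclNorm (LXpᵀ *ᵥ g) = euclNorm ((LXpᵀ * PZ) *ᵥ (PZᵀ *ᵥ g)) := by
          rw [← Matrix.mulVec_mulVec, ← hgP]
      _ ≤ specNorm (LXpᵀ * PZ) * euclNorm (PZᵀ *ᵥ g) := spec_le _ _
      _ ≤ ε * euclNorm g := mul_le_mul h3 (en_iso_t hPZ1 g) (en_nonneg _) hε0
  have hpyth : euclNorm g ^ 2 = euclNorm (H *ᵥ x) ^ 2
      + euclNorm (g - LX *ᵥ (H *ᵥ x)) ^ 2 := by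
    rw [hdec, en_iso hLXp1, en_sq, en_sq, en_sq, ← hUg]
    exact hsplit2 g
  have hg0 := en_nonneg g
  have hh0 := en_nonneg (H *ᵥ x)
  have hg2 : euclNorm g ≤ 2 * euclNorm (H *ᵥ x) := by
    have h6 : euclNorm (g - LX *ᵥ (H *ᵥ x)) ≤ 1 / 100 * euclNorm g :=
      hek.trans (mul_le_mul_of_nonneg_right hε1 hg0)
    have h7 := pow_le_pow_left₀ (en_nonneg _) h6 2
    refine (sq_le_sq₀ hg0 (by positivity)).1 ?_
    nlinarith [sq_nonneg (euclNorm (H *ᵥ x)), sq_nonneg (euclNorm g)]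
  have he : N * euclNorm (g - LX *ᵥ (H *ᵥ x)) ≤ 2 * (1 / 100) * σm * euclNorm (H *ᵥ x) := by
    calc N * euclNorm (g - LX *ᵥ (H *ᵥ x)) ≤ N * (ε * euclNorm g) :=
          mul_le_mul_of_nonneg_left hek hN0
      _ = 1 / 100 * σm * euclNorm g := by rw [← mul_assoc, hεN]
      _ ≤ 1 / 100 * σm * (2 * euclNorm (H *ᵥ x)) :=
          mul_le_mul_of_nonneg_left hg2 (by positivity)
      _ = _ := by ring
  have hcore := core_step hLXo hQt1 hSsym hSU (fun i => (hfacts i).1) hμ hσ hb0 hb2 hZt hZt' hΔt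
    hstep hQt2 x he hg2
  have hD := hcore.trans (dot_le _ _)
  have hmom := moment H (by positivity : 0 < 4 * N) hlow hs0 hup x hx
  have hms := hlow x
  rw [hx, mul_one] at hms
  have hsa : s ^ 2 ≤ 4 * N := by
    have ha := hup x
    rw [hx] at ha
    have := pow_le_pow_left₀ hs0 hms 2
    linarith
  exact scalar_final hs hms hμ hσ hμN hsa hmom hD

end AsymMatrixSensing
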